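/- Let M be an n×n homogeneous, well-ordered matrix of integers of degree d, and let M' be the (n−1)×n matrix obtained from M by erasing the first row. If Z is a zero-dimensional subscheme of P^2 having a dHB matrix equal to M', then the Hilbert function of Z at d−1 equals the degree of Z, i.e. Hf_Z(d−1) = deg(Z). -/

import Mathlib

open MvPolynomial Matrix

/-- `f` is a form of degree `m : ℤ` -/
def IsFormOfDeg {k : ℕ} (f : MvPolynomial (Fin k) ℂ) (m : ℤ) : Prop :=
  if m < 0 then f = 0 else f.IsHomogeneous m.toNat

def HasDegMatrix {k a b : ℕ} (N : Matrix (Fin a) (Fin b) (MvPolynomial (Fin k) ℂ))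
    (M : Matrix (Fin a) (Fin b) ℤ) : Prop :=
  ∀ i j, IsFormOfDeg (N i j) (M i j)

def IsHomogMatrix {a b : ℕ} (M : Matrix (Fin a) (Fin b) ℤ) : Prop :=
  ∀ (i i' : Fin a) (j j' : Fin b), i < i' → j < j' →
    M i j + M i' j' = M i j' + M i' j

def WellOrderedMatrix {a b : ℕ} (M : Matrix (Fin a) (Fin b) ℤ) : Prop :=
  (∀ (i i' : Fin a) (j : Fin b), i ≤ i' → M i' j ≤ M i j) ∧
  (∀ (i : Fin a) (j j' : Fin b), j ≤ j' → M i j ≤ M i j')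

/-- A property `P` holds for a general form of degree `d` in `k` variables. -/
def GeneralForm (k : ℕ) (d : ℤ) (P : MvPolynomial (Fin k) ℂ → Prop) : Prop :=
  ∃ Φ : MvPolynomial ((Fin k) →₀ ℕ) ℂ,
    (∃ f : MvPolynomial (Fin k) ℂ, IsFormOfDeg f d ∧ eval f.coeff Φ ≠ 0) ∧
    ∀ f : MvPolynomial (Fin k) ℂ, IsFormOfDeg f d → eval f.coeff Φ ≠ 0 → P f

noncomputable def minorsIdeal {k n : ℕ} (A : Matrix (Fin n) (Fin (n+1)) (MvPolynomial (Fin k) ℂ)) :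
    Ideal (MvPolynomial (Fin k) ℂ) :=
  Ideal.span (Set.range fun j : Fin (n+1) => (A.submatrix id j.succAbove).det)

def IsZeroDimIdeal (I : Ideal (MvPolynomial (Fin 3) ℂ)) : Prop :=
  ringKrullDim (MvPolynomial (Fin 3) ℂ ⧸ I) = 1

noncomputable def hilbFn (I : Ideal (MvPolynomial (Fin 3) ℂ)) (t : ℕ) : ℕ :=
  Module.finrank ℂ (homogeneousSubmodule (Fin 3) ℂ t) -
    Module.finrank ℂ
      (Submodule.restrictScalars ℂ I ⊓ homogeneousSubmodule (Fin 3) ℂ t : Submodule ℂ _)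

noncomputable def hilbFnZ (I : Ideal (MvPolynomial (Fin 3) ℂ)) (t : ℤ) : ℕ :=
  if t < 0 then 0 else hilbFn I t.toNat

def Cond2 {n : ℕ} (M : Matrix (Fin n) (Fin n) ℤ) : Prop :=
  ∀ (t : ℕ) (_ : 1 ≤ t) (h2 : t < n),
    M ⟨t, h2⟩ ⟨t - 1, by omega⟩ < 0 →
      ((∑ i : Fin (n - t), M ⟨t + i.1, by have := i.2; omega⟩ ⟨t + i.1, by have := i.2; omega⟩) = 0
        ∨ (∑ i : Fin (n - t), M ⟨t + i.1, by have := i.2; omega⟩ ⟨t + i.1, by have := i.2; omega⟩)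
            = ∑ i, M i i)

/-- The maximal minors of `A`, with alternating signs. -/
def signedMinor {R : Type*} [CommRing R] {k : ℕ} (A : Matrix (Fin k) (Fin (k + 1)) R)
    (j : Fin (k + 1)) : R :=
  (-1) ^ (j : ℕ) * (A.submatrix id j.succAbove).det

theorem dvd_of_forall_dvd_mul {R : Type*} [CommRing R] [UniqueFactorizationMonoid R]
    {ι : Type*} [Fintype ι] {f : ι → R}
    (hf : ∀ g, (∀ j, g ∣ f j) → IsUnit g) {a c : R} (h : ∀ j, a ∣ c * f j) : a ∣ c := by
  classical
  let := UniqueFactorizationMonoid.strongNormalizationMonoid (α := R)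
  let := UniqueFactorizationMonoid.toStrongNormalizedGCDMonoid R
  have h1 : a ∣ Finset.univ.gcd fun j => c * f j := Finset.dvd_gcd fun j _ => h j
  rw [Finset.gcd_mul_left] at h1
  have h2 : IsUnit (Finset.univ.gcd f) := hf _ fun j => Finset.gcd_dvd (Finset.mem_univ j)
  exact dvd_normalize_iff.mp (h2.dvd_mul_right.mp h1)

section HilbertBurch

variable {R : Type*} [CommRing R] {k : ℕ} (A : Matrix (Fin k) (Fin (k + 1)) R)

theorem sum_row_mul_signedMinor (i : Fin k) : ∑ j, A i j * signedMinor A j = 0 := by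
  let B : Matrix (Fin (k + 1)) (Fin (k + 1)) R := A.submatrix (Fin.cons i id) id
  have hB : B.det = 0 :=
    Matrix.det_zero_of_row_eq (i := 0) (j := i.succ) (Fin.succ_ne_zero i).symm rfl
  rw [Matrix.det_succ_row_zero] at hB
  rw [← hB]
  refine Finset.sum_congr rfl fun j _ => ?_
  have h1 : B.submatrix Fin.succ j.succAbove = A.submatrix id j.succAbove := rfl
  have h2 : B 0 j = A i j := rfl
  rw [h1, h2, signedMinor]
  ring

theorem sum_vecMul_mul_signedMinor (c : Fin k → R) :
    ∑ j, (c ᵥ* A) j * signedMinor A j = 0 := by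
  have : ∑ j, (c ᵥ* A) j * signedMinor A j = c ⬝ᵥ (A *ᵥ signedMinor A) := by
    rw [Matrix.dotProduct_mulVec]; rfl
  rw [this]
  have : A *ᵥ signedMinor A = 0 := funext fun i => sum_row_mul_signedMinor A i
  simp [this]

variable [IsDomain R]

theorem vecMul_injective_of_signedMinor_ne_zero {j : Fin (k + 1)} (hj : signedMinor A j ≠ 0) :
    Function.Injective fun c : Fin k → R => c ᵥ* A := by
  have hdet : (A.submatrix id j.succAbove).det ≠ 0 := right_ne_zero_of_mul hj
  intro c c' h
  refine sub_eq_zero.mp (Matrix.eq_zero_of_vecMul_eq_zero hdet ?_)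
  have h0 : (c - c') ᵥ* A = 0 := by
    rw [Matrix.sub_vecMul]; exact sub_eq_zero.mpr h
  ext b
  exact congrFun h0 (j.succAbove b)

theorem exists_vecMul_eq_signedMinor_smul {v : Fin (k + 1) → R}
    (hv : ∑ j, v j * signedMinor A j = 0) (j : Fin (k + 1)) :
    ∃ c : Fin k → R, c ᵥ* A = signedMinor A j • v := by
  by_cases hj : signedMinor A j = 0
  · exact ⟨0, by simp [hj]⟩
  set B := A.submatrix id j.succAbove with hB
  let c : Fin k → R := (-1 : R) ^ (j : ℕ) • ((fun b => v (j.succAbove b)) ᵥ* B.adjugate)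
  have hc : ∀ b, (c ᵥ* A) (j.succAbove b) = signedMinor A j * v (j.succAbove b) := by
    intro b
    have h1 : (c ᵥ* A) (j.succAbove b) = (c ᵥ* B) b := rfl
    rw [h1, Matrix.smul_vecMul, Matrix.vecMul_vecMul, Matrix.adjugate_mul]
    simp [Matrix.vecMul_smul, signedMinor, hB, mul_assoc]
  refine ⟨c, ?_⟩
  have hsum : ∑ l, ((c ᵥ* A) l - signedMinor A j * v l) * signedMinor A l = 0 := by
    simp only [sub_mul, Finset.sum_sub_distrib, sum_vecMul_mul_signedMinor, mul_assoc]
    rw [← Finset.mul_sum, hv]; simp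
  rw [Fin.sum_univ_succAbove _ j] at hsum
  simp only [hc, sub_self, zero_mul, Finset.sum_const_zero, add_zero] at hsum
  have hjj := sub_eq_zero.mp ((mul_eq_zero.mp hsum).resolve_right hj)
  ext l
  rcases Fin.eq_self_or_eq_succAbove j l with rfl | ⟨b, rfl⟩
  · exact hjj
  · exact hc b

/-- The exactness part of the Hilbert–Burch theorem over a factorial domain. -/
theorem exists_vecMul_eq [UniqueFactorizationMonoid R]
    (hA : ∀ g, (∀ j, g ∣ signedMinor A j) → IsUnit g) {v : Fin (k + 1) → R}
    (hv : ∑ j, v j * signedMinor A j = 0) : ∃ c : Fin k → R, c ᵥ* A = v := by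
  obtain ⟨j, hj⟩ : ∃ j, signedMinor A j ≠ 0 := by
    by_contra! h
    exact not_isUnit_zero (hA 0 fun j => by simp [h j])
  choose c hc using exists_vecMul_eq_signedMinor_smul A hv
  have key : ∀ l, signedMinor A l • c j = signedMinor A j • c l := fun l =>
    vecMul_injective_of_signedMinor_ne_zero A hj <| by
      simp only [Matrix.smul_vecMul, hc, smul_smul, mul_comm]
  have hdvd : ∀ i, signedMinor A j ∣ c j i := fun i =>
    dvd_of_forall_dvd_mul hA fun l =>
      ⟨c l i, by simpa [mul_comm] using congrFun (key l) i⟩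
  choose e he using hdvd
  refine ⟨e, ?_⟩
  have h1 : signedMinor A j • (e ᵥ* A) = signedMinor A j • v := by
    rw [← hc j, ← Matrix.smul_vecMul]
    congr 1
    ext i
    simp [he i]
  exact smul_right_injective _ hj h1

end HilbertBurch

theorem Polynomial.height_comap_C_add_one {R : Type*} [CommRing R] [IsNoetherianRing R]
    [IsJacobsonRing R] (Q : Ideal (Polynomial R)) [hQ : Q.IsMaximal] :
    (Q.comap Polynomial.C).IsMaximal ∧ Q.height = (Q.comap Polynomial.C).height + 1 := by
  have : Q.LiesOver (Q.comap Polynomial.C) := ⟨rfl⟩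
  exact ⟨Polynomial.isMaximal_comap_C_of_isJacobsonRing Q,
    Polynomial.height_eq_height_add_one _ Q⟩

theorem MvPolynomial.height_eq_of_isMaximal {K : Type*} [Field K] (n : ℕ)
    (P : Ideal (MvPolynomial (Fin n) K)) [hP : P.IsMaximal] : P.height = n := by
  induction n with
  | zero =>
    have h := Ideal.height_le_ringKrullDim_of_ne_top hP.ne_top
    rw [MvPolynomial.ringKrullDim_of_isNoetherianRing, ringKrullDim_eq_zero_of_field] at h
    simpa using h
  | succ n ih =>
    let e := (finSuccEquiv K n).toRingEquiv
    let Q := P.comap e.symm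
    have hQ : Q.IsMaximal := Ideal.comap_isMaximal_of_surjective _ e.symm.surjective
    have hQP : P.height = Q.height := (RingEquiv.height_comap e.symm P).symm
    obtain ⟨hq, hh⟩ := Polynomial.height_comap_C_add_one Q
    rw [hQP, hh, ih]
    simp

theorem isUnit_of_le_span_singleton {I : Ideal (MvPolynomial (Fin 3) ℂ)}
    (hI : ringKrullDim (MvPolynomial (Fin 3) ℂ ⧸ I) = 1) {g : MvPolynomial (Fin 3) ℂ}
    (hg : I ≤ Ideal.span {g}) : IsUnit g := by
  by_contra hu
  obtain ⟨P, hP, hgP⟩ := Ideal.exists_le_maximal (Ideal.span {g})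
    (by rwa [Ne, Ideal.span_singleton_eq_top])
  have h1 := Ideal.height_le_ringKrullDim_quotient_add_encard (p := P) ({g} : Set _) (by
    simpa [Ideal.span_le] using hgP)
  have h2 : ringKrullDim (MvPolynomial (Fin 3) ℂ ⧸ Ideal.span {g}) ≤ 1 :=
    hI ▸ ringKrullDim_le_of_surjective _ (Ideal.Quotient.factor_surjective hg)
  rw [MvPolynomial.height_eq_of_isMaximal 3 P, Set.encard_singleton] at h1
  have h3 : ((3 : ℕ∞) : WithBot ℕ∞) ≤ ((1 : ℕ∞) : WithBot ℕ∞) + ((1 : ℕ∞) : WithBot ℕ∞) :=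
    h1.trans (by gcongr; exact h2)
  norm_cast at h3

/-- The forms of degree `m : ℤ`, as a subspace of the polynomial ring in three variables. -/
noncomputable def formSubmodule (m : ℤ) : Submodule ℂ (MvPolynomial (Fin 3) ℂ) :=
  if m < 0 then ⊥ else homogeneousSubmodule (Fin 3) ℂ m.toNat

theorem mem_formSubmodule {m : ℤ} {f : MvPolynomial (Fin 3) ℂ} :
    f ∈ formSubmodule m ↔ IsFormOfDeg f m := by
  unfold formSubmodule IsFormOfDeg
  split_ifs <;> simp

theorem isFormOfDeg_iff_coeff {k : ℕ} {m : ℤ} {f : MvPolynomial (Fin k) ℂ} :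
    IsFormOfDeg f m ↔ ∀ s : Fin k →₀ ℕ, f.coeff s ≠ 0 → (s.degree : ℤ) = m := by
  unfold IsFormOfDeg
  split_ifs with h
  · refine ⟨fun hf s hs => absurd (by simp [hf]) hs, fun H => ?_⟩
    ext s
    by_contra hs
    have := H s (by simpa using hs)
    omega
  · refine ⟨fun hf s hs => ?_, fun H s hs => ?_⟩
    · have : s.degree = m.toNat := by
        by_contra h'
        exact hs (hf.coeff_eq_zero h')
      omega
    · have := H s hs
      have h2 : s.degree = m.toNat := by omega
      rw [← h2, Finsupp.degree_eq_weight_one]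
      rfl

theorem IsFormOfDeg.mul {k : ℕ} {m n : ℤ} {f g : MvPolynomial (Fin k) ℂ}
    (hf : IsFormOfDeg f m) (hg : IsFormOfDeg g n) : IsFormOfDeg (f * g) (m + n) := by
  classical
  rw [isFormOfDeg_iff_coeff] at *
  intro s hs
  rw [coeff_mul] at hs
  obtain ⟨p, hp, hne⟩ := Finset.exists_ne_zero_of_sum_ne_zero hs
  rw [← hf p.1 (left_ne_zero_of_mul hne), ← hg p.2 (right_ne_zero_of_mul hne),
    ← Finset.HasAntidiagonal.mem_antidiagonal.mp hp]
  simp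

theorem isFormOfDeg_C {k : ℕ} (r : ℂ) : IsFormOfDeg (C r : MvPolynomial (Fin k) ℂ) 0 := by
  simpa [IsFormOfDeg] using isHomogeneous_C (Fin k) r

theorem IsFormOfDeg.sum {k : ℕ} {ι : Type*} (s : Finset ι) {f : ι → MvPolynomial (Fin k) ℂ}
    {m : ℤ} (hf : ∀ i ∈ s, IsFormOfDeg (f i) m) : IsFormOfDeg (∑ i ∈ s, f i) m := by
  simp only [isFormOfDeg_iff_coeff] at *
  intro u hu
  rw [coeff_sum] at hu
  obtain ⟨i, hi, hne⟩ := Finset.exists_ne_zero_of_sum_ne_zero hu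
  exact hf i hi u hne

theorem IsFormOfDeg.prod {k : ℕ} {ι : Type*} (s : Finset ι) {f : ι → MvPolynomial (Fin k) ℂ}
    {m : ι → ℤ} (hf : ∀ i ∈ s, IsFormOfDeg (f i) (m i)) :
    IsFormOfDeg (∏ i ∈ s, f i) (∑ i ∈ s, m i) := by
  classical
  induction s using Finset.induction_on with
  | empty => simpa using isFormOfDeg_C (k := k) 1
  | insert a s ha ih =>
    rw [Finset.prod_insert ha, Finset.sum_insert ha]
    exact (hf a (Finset.mem_insert_self a s)).mul
      (ih fun i hi => hf i (Finset.mem_insert_of_mem hi))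

theorem HasDegMatrix.det {k n : ℕ} {N : Matrix (Fin n) (Fin n) (MvPolynomial (Fin k) ℂ)}
    {b a : Fin n → ℤ} (hN : HasDegMatrix N (Matrix.of fun i j => b i - a j)) :
    IsFormOfDeg N.det (∑ i, b i - ∑ j, a j) := by
  rw [Matrix.det_apply]
  refine IsFormOfDeg.sum _ fun σ _ => ?_
  have h1 : IsFormOfDeg (∏ i, N (σ i) i) (∑ i, (b (σ i) - a i)) :=
    IsFormOfDeg.prod _ fun i _ => hN (σ i) i
  rw [Finset.sum_sub_distrib, Equiv.sum_comp σ b] at h1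
  have h2 := (isFormOfDeg_C (k := k) ((Equiv.Perm.sign σ : ℤ) : ℂ)).mul h1
  rw [zero_add] at h2
  convert h2 using 1
  rw [Units.smul_def, zsmul_eq_mul]
  simp

theorem HasDegMatrix.signedMinor {k n : ℕ}
    {A : Matrix (Fin n) (Fin (n + 1)) (MvPolynomial (Fin k) ℂ)} {b : Fin n → ℤ}
    {a : Fin (n + 1) → ℤ} (hA : HasDegMatrix A (Matrix.of fun i j => b i - a j))
    (j : Fin (n + 1)) : IsFormOfDeg (signedMinor A j) (∑ i, b i - ∑ l, a l + a j) := by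
  have h1 : HasDegMatrix (A.submatrix id j.succAbove)
      (Matrix.of fun i l => b i - a (j.succAbove l)) := fun i l => hA i (j.succAbove l)
  have h2 := (isFormOfDeg_C (k := k) ((-1) ^ (j : ℕ))).mul h1.det
  rw [Fin.sum_univ_succAbove a j]
  convert h2 using 1
  · simp [_root_.signedMinor]
  · ring

/-- The projection of a polynomial to its part of degree `m : ℤ`. -/
noncomputable def formComponent (m : ℤ) :
    MvPolynomial (Fin 3) ℂ →ₗ[ℂ] MvPolynomial (Fin 3) ℂ :=
  if m < 0 then 0 else homogeneousComponent m.toNat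

theorem coeff_formComponent (m : ℤ) (f : MvPolynomial (Fin 3) ℂ) (s : Fin 3 →₀ ℕ) :
    (formComponent m f).coeff s = if (s.degree : ℤ) = m then f.coeff s else 0 := by
  unfold formComponent
  split_ifs with h h' h'
  · omega
  · simp
  · rw [coeff_homogeneousComponent, if_pos (by omega)]
  · rw [coeff_homogeneousComponent, if_neg (by omega)]

theorem isFormOfDeg_formComponent (m : ℤ) (f : MvPolynomial (Fin 3) ℂ) :
    IsFormOfDeg (formComponent m f) m := by
  rw [isFormOfDeg_iff_coeff]
  intro s hs
  by_contra h
  simp [coeff_formComponent, h] at hs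

theorem formComponent_eq_self {m : ℤ} {f : MvPolynomial (Fin 3) ℂ} (hf : IsFormOfDeg f m) :
    formComponent m f = f := by
  ext s
  rw [coeff_formComponent]
  split_ifs with h
  · rfl
  · by_contra h'
    exact h (isFormOfDeg_iff_coeff.mp hf s (Ne.symm h'))

theorem formComponent_mul {m e : ℤ} (f : MvPolynomial (Fin 3) ℂ) {g : MvPolynomial (Fin 3) ℂ}
    (hg : IsFormOfDeg g e) : formComponent m (f * g) = formComponent (m - e) f * g := by
  classical
  rw [isFormOfDeg_iff_coeff] at hg
  ext s
  rw [coeff_formComponent, coeff_mul, coeff_mul]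
  have key : ∀ p ∈ Finset.HasAntidiagonal.antidiagonal s, (formComponent (m - e) f).coeff p.1 * g.coeff p.2 =
      if (s.degree : ℤ) = m then f.coeff p.1 * g.coeff p.2 else 0 := by
    intro p hp
    by_cases h0 : g.coeff p.2 = 0
    · simp [h0]
    · have h1 := hg p.2 h0
      have h2 : (s.degree : ℤ) = p.1.degree + p.2.degree := by
        rw [← Finset.HasAntidiagonal.mem_antidiagonal.mp hp]; simp
      rw [coeff_formComponent]
      by_cases h3 : (s.degree : ℤ) = m
      · rw [if_pos h3, if_pos (by omega)]
      · rw [if_neg h3, if_neg (by omega), zero_mul]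
  rw [Finset.sum_congr rfl key]
  split_ifs <;> simp

theorem formComponent_vecMul {n l : ℕ} {m : ℤ}
    {A : Matrix (Fin n) (Fin l) (MvPolynomial (Fin 3) ℂ)} {b : Fin n → ℤ} {a : Fin l → ℤ}
    (hA : HasDegMatrix A (Matrix.of fun i j => b i - a j)) (c : Fin n → MvPolynomial (Fin 3) ℂ)
    (j : Fin l) : formComponent (m - a j) ((c ᵥ* A) j) =
      ((fun i => formComponent (m - b i) (c i)) ᵥ* A) j := by
  simp only [Matrix.vecMul, dotProduct, map_sum]
  refine Finset.sum_congr rfl fun i _ => ?_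
  rw [formComponent_mul (c i) (hA i j)]
  simp

theorem formSubmodule_of_neg {m : ℤ} (hm : m < 0) : formSubmodule m = ⊥ := if_pos hm

theorem formSubmodule_natCast (t : ℕ) :
    formSubmodule t = homogeneousSubmodule (Fin 3) ℂ t := by
  simp [formSubmodule]

instance (m : ℤ) : FiniteDimensional ℂ (formSubmodule m) := by
  rcases lt_or_ge m 0 with h | h
  · rw [formSubmodule_of_neg h]
    infer_instance
  · obtain ⟨t, rfl⟩ := Int.eq_ofNat_of_zero_le h
    rw [formSubmodule_natCast]
    exact Module.Finite.iff_fg.mpr (homogeneousSubmodule_fg ..)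

theorem finrank_homogeneousSubmodule (t : ℕ) :
    Module.finrank ℂ (homogeneousSubmodule (Fin 3) ℂ t) = (t + 2).choose 2 := by
  have h : {d : Fin 3 →₀ ℕ | d.degree = t} = ((Finset.univ : Finset (Fin 3)).finsuppAntidiag t) := by
    ext d
    simp [Finsupp.degree_eq_sum]
  rw [homogeneousSubmodule_eq_finsupp_supported, h,
    (AddMonoidAlgebra.supportedEquivFinsupp _).finrank_eq, Module.finrank_finsupp_self]
  simp only [Finset.coe_sort_coe, Fintype.card_coe, Finset.card_finsuppAntidiag_nat_eq_choose]
  rw [show (Finset.univ : Finset (Fin 3)).card + t - 1 = t + 2 by simp; omega]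
  exact (Nat.choose_symm_add).symm ▸ rfl

theorem two_mul_finrank_formSubmodule {m : ℤ} (hm : -1 ≤ m) :
    2 * (Module.finrank ℂ (formSubmodule m) : ℤ) = (m + 2) * (m + 1) := by
  rcases lt_or_ge m 0 with h | h
  · obtain rfl : m = -1 := by omega
    rw [formSubmodule_of_neg h]
    simp
  · obtain ⟨t, rfl⟩ := Int.eq_ofNat_of_zero_le h
    rw [formSubmodule_natCast, finrank_homogeneousSubmodule]
    have h2 : (t + 2) * (t + 1) = (t + 2).choose 2 * 2 := by
      simpa using Nat.add_one_mul_choose_eq (t + 1) 1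
    push_cast [← @Nat.cast_inj ℤ] at h2
    linarith

theorem minorsIdeal_eq_span_signedMinor {k n : ℕ}
    (A : Matrix (Fin n) (Fin (n + 1)) (MvPolynomial (Fin k) ℂ)) :
    minorsIdeal A = Ideal.span (Set.range (signedMinor A)) := by
  apply le_antisymm <;> refine Ideal.span_le.mpr ?_ <;> rintro _ ⟨j, rfl⟩
  · have : (A.submatrix id j.succAbove).det = (-1) ^ (j : ℕ) * signedMinor A j := by
      rw [signedMinor, ← mul_assoc, ← mul_pow]
      simp
    show (A.submatrix id j.succAbove).det ∈ _
    rw [this]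
    exact Ideal.mul_mem_left _ _ (Ideal.subset_span ⟨j, rfl⟩)
  · exact Ideal.mul_mem_left _ _ (Ideal.subset_span ⟨j, rfl⟩)

/-- The dimension count in degree `t` given by the Hilbert–Burch resolution. -/
theorem finrank_minorsIdeal_inf_add {n : ℕ}
    {A : Matrix (Fin n) (Fin (n + 1)) (MvPolynomial (Fin 3) ℂ)} {b : Fin n → ℤ}
    {a : Fin (n + 1) → ℤ} (hA : HasDegMatrix A (Matrix.of fun i j => b i - a j))
    (hg : ∀ g, (∀ j, g ∣ signedMinor A j) → IsUnit g) (t : ℕ) :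
    Module.finrank ℂ (Submodule.restrictScalars ℂ (minorsIdeal A) ⊓
        homogeneousSubmodule (Fin 3) ℂ t : Submodule ℂ _) +
      ∑ i, Module.finrank ℂ (formSubmodule (t - (∑ i, b i - ∑ j, a j) - b i)) =
      ∑ j, Module.finrank ℂ (formSubmodule (t - (∑ i, b i - ∑ j, a j) - a j)) := by
  set D := ∑ i, b i - ∑ j, a j with hD
  have hform : ∀ j, IsFormOfDeg (signedMinor A j) (D + a j) := fun j => hA.signedMinor j
  let ι : (∀ j, formSubmodule (t - D - a j)) →ₗ[ℂ] (Fin (n + 1) → MvPolynomial (Fin 3) ℂ) :=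
    LinearMap.pi fun j => (formSubmodule (t - D - a j)).subtype ∘ₗ LinearMap.proj j
  let κ : (∀ i, formSubmodule (t - D - b i)) →ₗ[ℂ] (Fin n → MvPolynomial (Fin 3) ℂ) :=
    LinearMap.pi fun i => (formSubmodule (t - D - b i)).subtype ∘ₗ LinearMap.proj i
  have hι : Function.Injective ι := fun v w h => funext fun j => Subtype.ext (congrFun h j)
  have hκ : Function.Injective κ := fun v w h => funext fun j => Subtype.ext (congrFun h j)
  let φ : (Fin (n + 1) → MvPolynomial (Fin 3) ℂ) →ₗ[ℂ] MvPolynomial (Fin 3) ℂ :=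
    ∑ j, LinearMap.mulRight ℂ (signedMinor A j) ∘ₗ LinearMap.proj j
  have hφ : ∀ v, φ v = ∑ j, v j * signedMinor A j := fun v => by simp [φ]
  let ψ : (Fin n → MvPolynomial (Fin 3) ℂ) →ₗ[ℂ] (Fin (n + 1) → MvPolynomial (Fin 3) ℂ) :=
    (Matrix.vecMulLinear A).restrictScalars ℂ
  have hψ : ∀ c, ψ c = c ᵥ* A := fun c => rfl
  obtain ⟨j₀, hj₀⟩ : ∃ j, signedMinor A j ≠ 0 := by
    by_contra! h
    exact not_isUnit_zero (hg 0 fun j => by simp [h j])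
  have hψinj : Function.Injective ψ := vecMul_injective_of_signedMinor_ne_zero A hj₀
  have hcomp : ∀ v : Fin (n + 1) → MvPolynomial (Fin 3) ℂ, formComponent t (φ v) =
      φ fun j => formComponent (t - D - a j) (v j) := by
    intro v
    simp only [hφ, map_sum]
    refine Finset.sum_congr rfl fun j _ => ?_
    rw [formComponent_mul _ (hform j), sub_sub]
  have hrange : LinearMap.range (φ ∘ₗ ι) = (Submodule.restrictScalars ℂ (minorsIdeal A) ⊓
      homogeneousSubmodule (Fin 3) ℂ t : Submodule ℂ _) := by
    ext f
    have hhom : f ∈ homogeneousSubmodule (Fin 3) ℂ t ↔ IsFormOfDeg f t := by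
      simp [IsFormOfDeg]
    rw [Submodule.mem_inf, hhom, Submodule.restrictScalars_mem,
      minorsIdeal_eq_span_signedMinor, Ideal.mem_span_range_iff_exists_fun]
    constructor
    · rintro ⟨v, rfl⟩
      refine ⟨⟨ι v, (hφ (ι v)).symm⟩, ?_⟩
      rw [LinearMap.comp_apply, hφ]
      refine IsFormOfDeg.sum _ fun j _ => ?_
      have h := (mem_formSubmodule.mp (v j).2).mul (hform j)
      rwa [show (t : ℤ) - D - a j + (D + a j) = t by ring] at h
    · rintro ⟨⟨v, hv⟩, hf⟩
      refine ⟨fun j => ⟨formComponent (t - D - a j) (v j),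
        mem_formSubmodule.mpr (isFormOfDeg_formComponent _ _)⟩, ?_⟩
      rw [← formComponent_eq_self hf, ← hv, ← hφ, hcomp]
      rfl
  have hker : (LinearMap.ker (φ ∘ₗ ι)).map ι = LinearMap.range (ψ ∘ₗ κ) := by
    ext v
    constructor
    · rintro ⟨w, hw, rfl⟩
      have hw' : φ (ι w) = 0 := hw
      rw [hφ] at hw'
      obtain ⟨c, hc⟩ := exists_vecMul_eq A hg hw'
      refine ⟨fun i => ⟨formComponent (t - D - b i) (c i),
        mem_formSubmodule.mpr (isFormOfDeg_formComponent _ _)⟩, ?_⟩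
      ext1 j
      have hw : formComponent (t - D - a j) (ι w j) = ι w j :=
        formComponent_eq_self (mem_formSubmodule.mp (w j).2)
      rw [← hw, ← hc, formComponent_vecMul hA]
      rfl
    · rintro ⟨c, rfl⟩
      refine ⟨fun j => ⟨ψ (κ c) j, mem_formSubmodule.mpr ?_⟩, ?_, rfl⟩
      · refine IsFormOfDeg.sum _ fun i _ => ?_
        have h := (mem_formSubmodule.mp (c i).2).mul (hA i j)
        rwa [Matrix.of_apply, show (t : ℤ) - D - b i + (b i - a j) = t - D - a j by ring] at h
      · change φ (ψ (κ c)) = 0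
        rw [hφ, hψ]
        exact sum_vecMul_mul_signedMinor A _
  have h1 := LinearMap.finrank_range_add_finrank_ker (φ ∘ₗ ι)
  have h2 := LinearEquiv.finrank_eq (Submodule.equivMapOfInjective ι hι (LinearMap.ker (φ ∘ₗ ι)))
  rw [hker, LinearMap.finrank_range_of_inj (f := ψ ∘ₗ κ) (hψinj.comp hκ)] at h2
  rw [hrange, h2] at h1
  simpa only [Module.finrank_pi_fintype] using h1

theorem sum_sub_mul_sub {ι : Type*} [Fintype ι] (u : ℤ) (a : ι → ℤ) :
    ∑ j, (u - a j + 2) * (u - a j + 1) =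
      Fintype.card ι * ((u + 2) * (u + 1)) - (2 * u + 3) * ∑ j, a j + ∑ j, a j ^ 2 := by
  rw [Finset.mul_sum, ← nsmul_eq_mul, ← Finset.card_univ, ← Finset.sum_const,
    ← Finset.sum_sub_distrib, ← Finset.sum_add_distrib]
  exact Finset.sum_congr rfl fun j _ => by ring

/-- In large degrees, the Hilbert function read off from the Hilbert–Burch resolution. -/
theorem two_mul_hilbFn_minorsIdeal {n : ℕ}
    {A : Matrix (Fin n) (Fin (n + 1)) (MvPolynomial (Fin 3) ℂ)} {b : Fin n → ℤ}
    {a : Fin (n + 1) → ℤ} (hA : HasDegMatrix A (Matrix.of fun i j => b i - a j))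
    (hg : ∀ g, (∀ j, g ∣ signedMinor A j) → IsUnit g) (t : ℕ)
    (hta : ∀ j, -1 ≤ t - (∑ i, b i - ∑ j, a j) - a j)
    (htb : ∀ i, -1 ≤ t - (∑ i, b i - ∑ j, a j) - b i) :
    2 * (hilbFn (minorsIdeal A) t : ℤ) =
      max ((∑ i, b i - ∑ j, a j) ^ 2 + ∑ i, b i ^ 2 - ∑ j, a j ^ 2) 0 := by
  have h := congrArg (fun x : ℕ => 2 * (x : ℤ)) (finrank_minorsIdeal_inf_add hA hg t)
  set D := ∑ i, b i - ∑ j, a j with hD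
  push_cast at h
  rw [mul_add, Finset.mul_sum, Finset.mul_sum,
    Finset.sum_congr rfl fun i _ => two_mul_finrank_formSubmodule (htb i),
    Finset.sum_congr rfl fun j _ => two_mul_finrank_formSubmodule (hta j),
    sum_sub_mul_sub, sum_sub_mul_sub] at h
  have ht := two_mul_finrank_formSubmodule (m := t) (by omega)
  rw [formSubmodule_natCast] at ht
  simp only [Fintype.card_fin] at h
  push_cast at h
  have key : 2 * (Module.finrank ℂ (homogeneousSubmodule (Fin 3) ℂ t) : ℤ) -
      2 * (Module.finrank ℂ (Submodule.restrictScalars ℂ (minorsIdeal A) ⊓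
        homogeneousSubmodule (Fin 3) ℂ t : Submodule ℂ _) : ℤ) =
      D ^ 2 + ∑ i, b i ^ 2 - ∑ j, a j ^ 2 := by
    have hb : ∑ i, b i = D + ∑ j, a j := by rw [hD]; ring
    rw [hb] at h
    linear_combination ht - h
  rw [← key, hilbFn]
  omega

theorem not_isUnit_signedMinor {n : ℕ}
    {A : Matrix (Fin n) (Fin (n + 1)) (MvPolynomial (Fin 3) ℂ)}
    (hz : IsZeroDimIdeal (minorsIdeal A)) (j : Fin (n + 1)) : ¬ IsUnit (signedMinor A j) := by
  intro hu
  have htop : minorsIdeal A = ⊤ := by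
    rw [minorsIdeal_eq_span_signedMinor]
    exact Ideal.eq_top_of_isUnit_mem _ (Ideal.subset_span ⟨j, rfl⟩) hu
  rw [IsZeroDimIdeal, htop] at hz
  have : Subsingleton (MvPolynomial (Fin 3) ℂ ⧸ (⊤ : Ideal (MvPolynomial (Fin 3) ℂ))) :=
    Ideal.Quotient.subsingleton_iff.mpr rfl
  rw [ringKrullDim_eq_bot_of_subsingleton] at hz
  exact absurd hz (by simp)

theorem isUnit_of_forall_dvd_signedMinor {n : ℕ}
    {A : Matrix (Fin n) (Fin (n + 1)) (MvPolynomial (Fin 3) ℂ)}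
    (hz : IsZeroDimIdeal (minorsIdeal A)) (g : MvPolynomial (Fin 3) ℂ)
    (hg : ∀ j, g ∣ signedMinor A j) : IsUnit g := by
  refine isUnit_of_le_span_singleton hz ?_
  rw [minorsIdeal_eq_span_signedMinor, Ideal.span_le]
  rintro _ ⟨j, rfl⟩
  exact Ideal.mem_span_singleton.mpr (hg j)

theorem IsFormOfDeg.eq_zero_or_isUnit {k : ℕ} {m : ℤ} {f : MvPolynomial (Fin k) ℂ}
    (hf : IsFormOfDeg f m) (hm : m ≤ 0) : f = 0 ∨ IsUnit f := by
  rcases hm.lt_or_eq with h | rfl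
  · exact Or.inl (by simpa [IsFormOfDeg, h] using hf)
  · have h0 : f.IsHomogeneous 0 := by simpa [IsFormOfDeg] using hf
    obtain ⟨r, rfl⟩ : ∃ r, f = C r :=
      ⟨_, totalDegree_eq_zero_iff_eq_C.mp (Nat.le_zero.mp h0.totalDegree_le)⟩
    by_cases hr : r = 0
    · exact Or.inl (by simp [hr])
    · exact Or.inr ((IsUnit.mk0 r hr).map C)

/-- (Proposition 5.8.)  Let `M` be a homogeneous well-ordered `(k+1)×(k+1)` integer
matrix of degree `d` and `M'` the matrix obtained by erasing its first row.  If `Z` is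
a zero-dimensional subscheme of `ℙ²` with dHB matrix `M'` (encoded by a matrix of forms
`A` with degree matrix `M'` whose maximal minors generate the ideal of `Z`), then the
Hilbert function of `Z` at `d - 1` equals the degree of `Z`, i.e. the Hilbert function
is eventually equal to its value at `d - 1`. -/
theorem stmt_12 {k : ℕ} (M : Matrix (Fin (k + 1)) (Fin (k + 1)) ℤ)
    (hM : IsHomogMatrix M) (hMw : WellOrderedMatrix M)
    (d : ℤ) (hd : d = ∑ i, M i i)
    (M' : Matrix (Fin k) (Fin (k + 1)) ℤ) (hM' : M' = M.submatrix Fin.succ id)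
    (A : Matrix (Fin k) (Fin (k + 1)) (MvPolynomial (Fin 3) ℂ))
    (hA : HasDegMatrix A M') (hz : IsZeroDimIdeal (minorsIdeal A)) :
    ∀ᶠ t : ℕ in Filter.atTop,
      hilbFn (minorsIdeal A) t = hilbFnZ (minorsIdeal A) (d - 1) := by
  set b : Fin k → ℤ := fun i => M i.succ 0 with hb
  set a : Fin (k + 1) → ℤ := fun j => M 0 0 - M 0 j with ha
  have hMab : ∀ (i : Fin k) j, M i.succ j = b i - a j := by
    intro i j
    rcases Fin.eq_zero_or_eq_succ j with rfl | ⟨j, rfl⟩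
    · simp [ha, hb]
    · have := hM 0 i.succ 0 j.succ (Fin.succ_pos i) (Fin.succ_pos j)
      simp only [ha, hb]
      linarith
  have hAab : HasDegMatrix A (Matrix.of fun i j => b i - a j) := by
    intro i j
    simpa [hM', hMab] using hA i j
  have hdD : d = ∑ i, b i - ∑ j, a j + M 0 0 := by
    rw [hd, Fin.sum_univ_succ, Fin.sum_univ_succ a, show a 0 = 0 by simp [ha]]
    simp only [hMab, Finset.sum_sub_distrib]
    ring
  have hg := isUnit_of_forall_dvd_signedMinor hz
  have hnu := not_isUnit_signedMinor hz
  have h00 : 0 ≤ M 0 0 := by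
    by_contra! h
    refine hnu 0 (hg _ fun j => ?_)
    rcases Fin.eq_zero_or_eq_succ j with rfl | ⟨j, rfl⟩
    · exact dvd_rfl
    · have hk : NeZero k := ⟨fun hk => (hk ▸ j).elim0⟩
      have hzero : signedMinor A j.succ = 0 := by
        rw [signedMinor, Matrix.det_eq_zero_of_column_eq_zero 0, mul_zero]
        intro i
        have h1 := hAab i 0
        have h2 : M i.succ 0 < 0 := (hMw.1 0 i.succ 0 (Fin.zero_le _)).trans_lt h
        rw [Matrix.of_apply, ← hMab, IsFormOfDeg, if_pos h2] at h1
        simpa [Fin.succAbove_ne_zero_zero (Fin.succ_ne_zero j)] using h1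
      rw [hzero]
      exact dvd_zero _
  have h0j : ∀ j, 0 ≤ M 0 j := fun j => h00.trans (hMw.2 0 0 j (Fin.zero_le j))
  have hdpos : 1 ≤ d := by
    by_contra! h
    refine not_isUnit_zero (hg 0 fun j => ?_)
    have h1 : ∑ i, b i - ∑ l, a l + a j ≤ 0 := by
      have := h0j j
      simp only [ha] at hdD ⊢
      linarith
    rcases (hAab.signedMinor j).eq_zero_or_isUnit h1 with h2 | h2
    · rw [h2]
    · exact absurd h2 (hnu j)
  have key : ∀ t : ℕ, d - 1 ≤ t → 2 * (hilbFn (minorsIdeal A) t : ℤ) =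
      max ((∑ i, b i - ∑ j, a j) ^ 2 + ∑ i, b i ^ 2 - ∑ j, a j ^ 2) 0 := by
    intro t ht
    refine two_mul_hilbFn_minorsIdeal hAab hg t (fun j => ?_) (fun i => ?_)
    · have := h0j j
      have haj : a j = M 0 0 - M 0 j := rfl
      linarith
    · have hbi : b i ≤ M 0 0 := hMw.1 0 i.succ 0 (Fin.zero_le _)
      linarith
  filter_upwards [Filter.eventually_ge_atTop (d - 1).toNat] with t ht
  rw [hilbFnZ, if_neg (by omega)]
  have h1 := key t (by omega)
  have h2 := key (d - 1).toNat (by omega)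
  omega
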